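/- arXiv:1403.0838 — 2 statements merged into one kernel-verified Lean document; each statement's English description precedes it below -/
import Mathlib

section
/- (Reynolds transport theorem, Lagrangian form) Let φ(t) be the flow of a C¹ vector field V and T(y,t) a C¹ scalar function. Then for W(t) = φ(t)(W₀), d/dt ∫_{W(t)} T(y,t) dy = ∫_{W₀} [∂ₜ T̄(x,t) + T̄(x,t)·(div V)(φ(t)x)] |K(x,t)| dx, where T̄(x,t) = T(φ(t)x, t) and |K(x,t)| = det Dφ(t)(x). -/
open MeasureTheory

open Set Filter Topology in
theorem rt_stay {E : Type*} [NormedAddCommGroup E] [NormedSpace ℝ E]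
    (V : E → E) (hV : Continuous V) (y : E) {ρ₀ : ℝ} (hρ₀ : 0 < ρ₀) :
    ∃ ρ > 0, ∃ δ > 0, ∀ γ : ℝ → E, (∀ t, HasDerivAt γ (V (γ t)) t) → 
      γ 0 ∈ Metric.closedBall y ρ → ∀ s ∈ Icc 0 δ, γ s ∈ Metric.closedBall y ρ₀ := by
  have h1 : ∀ᶠ z in 𝓝 y, ‖V z‖ < ‖V y‖ + 1 :=
    (hV.norm.continuousAt).eventually_lt continuousAt_const (by simp)
  obtain ⟨r, hr, hrV⟩ := Metric.eventually_nhds_iff.1 h1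
  set M := ‖V y‖ + 1 with hM
  have hMpos : 0 < M := by positivity
  set ρ := min (r / 2) ρ₀ with hρd
  have hρ : 0 < ρ := by positivity
  have hρr : ρ < r := lt_of_le_of_lt (min_le_left _ _) (by linarith)
  refine ⟨ρ / 2, by positivity, ρ / (2 * M), by positivity, fun γ hγ h0 s hs => ?_⟩
  have key := image_norm_le_of_norm_deriv_right_lt_deriv_boundary' (f := fun s => γ s - y)
    (f' := fun s => V (γ s)) (a := 0) (b := ρ / (2 * M)) (B := fun s => ρ / 2 + M * s)
    (B' := fun _ => M) 
    (fun t _ => ((hγ t).sub_const y).continuousAt.continuousWithinAt)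
    (fun t _ => ((hγ t).sub_const y).hasDerivWithinAt)
    (by simpa [dist_eq_norm] using h0) (by fun_prop)
    (fun t _ => by
      simpa using (((hasDerivAt_id t).const_mul M).const_add (ρ / 2)).hasDerivWithinAt)
    (fun t ht he => by
      apply hrV
      rw [dist_eq_norm, he]
      have : M * t ≤ M * (ρ / (2 * M)) := by gcongr; exact ht.2.le
      have e : M * (ρ / (2 * M)) = ρ / 2 := by field_simp
      linarith) hs
  have : M * s ≤ M * (ρ / (2 * M)) := by gcongr; exact hs.2
  have e : M * (ρ / (2 * M)) = ρ / 2 := by field_simp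
  rw [Metric.mem_closedBall, dist_eq_norm]
  have := min_le_right (r / 2) ρ₀
  linarith

open Set Filter Topology in
theorem rt_est {E : Type*} [NormedAddCommGroup E] [NormedSpace ℝ E]
    (V : E → E) (hV : Continuous V) (y : E) (A : E →L[ℝ] E) (hA : HasStrictFDerivAt V A y)
    {ε : ℝ} (hε : 0 < ε) :
    ∃ r > 0, ∃ δ > 0, ∀ γ₁ γ₂ : ℝ → E, (∀ t, HasDerivAt γ₁ (V (γ₁ t)) t) → 
      (∀ t, HasDerivAt γ₂ (V (γ₂ t)) t) →
      γ₁ 0 ∈ Metric.closedBall y r → γ₂ 0 ∈ Metric.closedBall y r → ∀ s ∈ Icc 0 δ, 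
      ‖γ₁ s - γ₂ s - (γ₁ 0 - γ₂ 0) - s • A (γ₁ 0 - γ₂ 0)‖ ≤ ε * s * ‖γ₁ 0 - γ₂ 0‖ := by
  set η : NNReal := ⟨ε / 4, by positivity⟩ with hη
  have hηε : (η : ℝ) = ε / 4 := rfl
  have hηpos : 0 < η := by rw [← NNReal.coe_pos, hηε]; positivity
  obtain ⟨S, hS, hap⟩ := hA.approximates_deriv_on_nhds (c := η) (Or.inr hηpos)
  obtain ⟨ρ₀, hρ₀, hρS⟩ := Metric.nhds_basis_closedBall.mem_iff.1 hS
  obtain ⟨r, hr, δ₀, hδ₀, hstay⟩ := rt_stay V hV y hρ₀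
  set L : NNReal := ‖A‖₊ + η with hL
  have hLpos : 0 < (L : ℝ) := by rw [NNReal.coe_pos]; positivity
  have hLip : LipschitzOnWith L V (Metric.closedBall y ρ₀) :=
    lipschitzOnWith_iff_restrict.2 (hap.mono_set hρS).lipschitz
  -- choose delta
  set δ : ℝ := min δ₀ (min (Real.log 2 / L) (ε / (4 * L * (‖A‖ + 1)))) with hδ
  have hlog : 0 < Real.log 2 := Real.log_pos (by norm_num)
  have hδpos : 0 < δ := by positivity
  refine ⟨r, hr, δ, hδpos, fun γ₁ γ₂ h₁ h₂ m₁ m₂ => ?_⟩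
  have hδδ₀ : δ ≤ δ₀ := min_le_left _ _
  have hδ1 : L * δ ≤ Real.log 2 := by
    have : δ ≤ Real.log 2 / L := (min_le_right _ _).trans (min_le_left _ _)
    rw [le_div_iff₀ hLpos] at this; linarith
  have hδ2 : δ * (4 * L * (‖A‖ + 1)) ≤ ε := by
    have : δ ≤ ε / (4 * L * (‖A‖ + 1)) := (min_le_right _ _).trans (min_le_right _ _)
    rwa [le_div_iff₀ (by positivity)] at this
  have s₁ : ∀ s ∈ Icc 0 δ, γ₁ s ∈ Metric.closedBall y ρ₀ := fun s hs =>
    hstay γ₁ h₁ m₁ s ⟨hs.1, hs.2.trans hδδ₀⟩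
  have s₂ : ∀ s ∈ Icc 0 δ, γ₂ s ∈ Metric.closedBall y ρ₀ := fun s hs =>
    hstay γ₂ h₂ m₂ s ⟨hs.1, hs.2.trans hδδ₀⟩
  set h := γ₁ 0 - γ₂ 0 with hh
  have hg : ∀ s ∈ Icc 0 δ, ‖γ₁ s - γ₂ s‖ ≤ 2 * ‖h‖ := by
    intro s hs
    have := dist_le_of_trajectories_ODE_of_mem (v := fun _ => V) (K := L) 
      (s := fun _ => Metric.closedBall y ρ₀) (f := γ₁) (g := γ₂) (a := 0) (b := δ) 
      (δ := ‖h‖)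
      (fun _ _ => hLip) (fun t _ => (h₁ t).continuousAt.continuousWithinAt)
      (fun t _ => (h₁ t).hasDerivWithinAt) (fun t ht => s₁ t (Ico_subset_Icc_self ht))
      (fun t _ => (h₂ t).continuousAt.continuousWithinAt)
      (fun t _ => (h₂ t).hasDerivWithinAt) (fun t ht => s₂ t (Ico_subset_Icc_self ht))
      (by rw [dist_eq_norm]) s hs
    rw [dist_eq_norm] at this
    have e2 : Real.exp (L * (s - 0)) ≤ 2 := by
      rw [← Real.exp_log (show (0:ℝ) < 2 by norm_num)]
      apply Real.exp_le_exp.2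
      have : (L:ℝ) * (s - 0) ≤ L * δ := by gcongr; linarith [hs.2]
      linarith
    have : ‖h‖ * Real.exp (L * (s - 0)) ≤ ‖h‖ * 2 := by gcongr
    linarith
  have hV' : ∀ s ∈ Icc 0 δ, ‖V (γ₁ s) - V (γ₂ s)‖ ≤ 2 * L * ‖h‖ := by
    intro s hs
    have := hLip.dist_le_mul _ (s₁ s hs) _ (s₂ s hs)
    rw [dist_eq_norm, dist_eq_norm] at this
    have h3 : L * ‖γ₁ s - γ₂ s‖ ≤ L * (2 * ‖h‖) := by gcongr; exact hg s hs
    linarith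
  have hgh : ∀ s ∈ Icc 0 δ, ‖γ₁ s - γ₂ s - h‖ ≤ 2 * L * ‖h‖ * δ := by
    intro s hs
    have := norm_image_sub_le_of_norm_deriv_le_segment' (f := fun s => γ₁ s - γ₂ s)
      (fun t _ => ((h₁ t).sub (h₂ t)).hasDerivWithinAt) 
      (fun t ht => hV' t (Ico_subset_Icc_self ht)) s hs
    refine this.trans ?_
    gcongr
    linarith [hs.2]
  intro s hs
  have fin := norm_image_sub_le_of_norm_deriv_le_segment' (a := 0) (b := δ) (C := ε * ‖h‖)
      (f := fun s => γ₁ s - γ₂ s - s • A h)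
      (fun t _ => (((h₁ t).sub (h₂ t)).sub ((hasDerivAt_id t).smul_const (A h))).hasDerivWithinAt) 
      (fun t ht => by
        have ht' := Ico_subset_Icc_self ht
        have a1 := hap _ (hρS (s₁ t ht')) _ (hρS (s₂ t ht'))
        have a2 : ‖A (γ₁ t - γ₂ t - h)‖ ≤ ‖A‖ * (2 * L * ‖h‖ * δ) :=
          (A.le_opNorm _).trans (by gcongr; exact hgh t ht')
        have a3 : V (γ₁ t) - V (γ₂ t) - (1:ℝ) • A h = 
          (V (γ₁ t) - V (γ₂ t) - A (γ₁ t - γ₂ t)) + A (γ₁ t - γ₂ t - h) := by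
          simp only [map_sub, one_smul]; abel
        rw [a3]
        refine (norm_add_le _ _).trans ?_
        have a4 : (η:ℝ) * ‖γ₁ t - γ₂ t‖ ≤ ε / 4 * (2 * ‖h‖) := by
          rw [hηε]; gcongr; exact hg t ht'
        have a5 : ‖A‖ * (2 * L * ‖h‖ * δ) ≤ ε / 2 * ‖h‖ := by
          have : (2 * ‖A‖ * L * δ) ≤ ε / 2 := by
            have : 0 ≤ δ * L := by positivity
            nlinarith
          nlinarith [norm_nonneg h]
        linarith) s hs
  simp only [zero_smul, sub_zero] at fin
  rw [show γ₁ s - γ₂ s - h - s • A h = γ₁ s - γ₂ s - s • A h - h by abel]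
  linarith

theorem rt_det {n : ℕ} (M : ℝ → ((Fin n → ℝ) →L[ℝ] (Fin n → ℝ))) (A : (Fin n → ℝ) →L[ℝ] (Fin n → ℝ))
    (h0 : M 0 = ContinuousLinearMap.id ℝ _) (hM : HasDerivAt M A 0) :
    HasDerivAt (fun s => LinearMap.det (M s).toLinearMap)
      (LinearMap.trace ℝ (Fin n → ℝ) A.toLinearMap) 0 := by
  let D : (Fin n → Fin n → ℝ) → ℝ := fun B => (Matrix.of B).det
  have hD : Differentiable ℝ D := by
    intro B
    simp only [D, Matrix.det_apply', Matrix.of_apply]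
    fun_prop
  let e : ((Fin n → ℝ) →L[ℝ] (Fin n → ℝ)) → (Fin n → Fin n → ℝ) :=
    fun B i j => B (Pi.single j 1) i
  have he : ∀ B, LinearMap.det (ContinuousLinearMap.toLinearMap B) = D (e B) := by
    intro B
    rw [← LinearMap.det_toMatrix']
    congr 1
  have htr : LinearMap.trace ℝ (Fin n → ℝ) A.toLinearMap = Matrix.trace (Matrix.of (e A)) := by
    rw [LinearMap.trace_eq_matrix_trace ℝ (Pi.basisFun ℝ (Fin n))]
    congr 1
  have hMe : HasDerivAt (fun s => e (M s)) (e A) 0 := by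
    rw [hasDerivAt_pi]; intro i
    rw [hasDerivAt_pi]; intro j
    have := hM.clm_apply (hasDerivAt_const (0:ℝ) (Pi.single j (1:ℝ) : Fin n → ℝ))
    have := (hasDerivAt_pi.1 this) i
    simpa [e] using this
  have hline : HasDerivAt (fun s : ℝ => e (ContinuousLinearMap.id ℝ _) + s • e A) (e A) 0 := by
    simpa using ((hasDerivAt_id (0:ℝ)).smul_const (e A)).const_add (e (ContinuousLinearMap.id ℝ _))
  have h1 := (hD (e (M 0))).hasFDerivAt.comp_hasDerivAt (0:ℝ) hMe
  have h2 := HasFDerivAt.comp_hasDerivAt_of_eq (l := D) (0:ℝ) (hD (e (M 0))).hasFDerivAt hline (by simp [h0])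
  have h3 : HasDerivAt (D ∘ (fun s : ℝ => e (ContinuousLinearMap.id ℝ _) + s • e A)) 
      (Matrix.trace (Matrix.of (e A))) 0 := by
    have hfun : (D ∘ (fun s : ℝ => e (ContinuousLinearMap.id ℝ _) + s • e A)) = fun s => 
        1 + (Matrix.trace (Matrix.of (e A))) * s + 
          (((1 + (Polynomial.X : Polynomial ℝ) • (Matrix.of (e A)).map Polynomial.C).det).divX.divX).eval s * s ^ 2 := by
      funext s
      rw [← Matrix.det_one_add_smul]
      simp only [D, Function.comp]
      congr 1
      ext i j
      simp [e, Matrix.one_apply, Pi.single_apply]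
    rw [hfun]
    have := (((hasDerivAt_id (0:ℝ)).const_mul (Matrix.trace (Matrix.of (e A)))).const_add 1).add
      ((Polynomial.hasDerivAt ((((1 + (Polynomial.X : Polynomial ℝ) • (Matrix.of (e A)).map Polynomial.C).det).divX.divX)) 0).mul ((hasDerivAt_id (0:ℝ)).pow 2))
    refine HasDerivAt.congr_deriv this ?_
    simp
  rw [htr]
  have h4 := h2.unique h3
  simp only [he]
  rw [← h4]
  exact h1

open Set Filter Topology in
theorem rt_cont {n : ℕ} (V : (Fin n → ℝ) → (Fin n → ℝ)) (φ : ℝ → (Fin n → ℝ) → (Fin n → ℝ))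
    (hV : Continuous V)
    (hflow : ∀ x t, HasDerivAt (fun s => φ s x) (V (φ t x)) t)
    (hφ0 : φ 0 = id)
    (hgroup : ∀ t s, φ (t + s) = φ t ∘ φ s)
    (hcont : ∀ t, Continuous (φ t)) :
    Continuous (fun p : ℝ × (Fin n → ℝ) => φ p.1 p.2) := by
  have h0 : ∀ y, ContinuousAt (fun p : ℝ × (Fin n → ℝ) => φ p.1 p.2) (0, y) := by
    intro y
    rw [ContinuousAt, Metric.nhds_basis_closedBall.tendsto_right_iff]
    intro ρ₀ hρ₀
    obtain ⟨r₁, hr₁, δ₁, hδ₁, H₁⟩ := rt_stay V hV y hρ₀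
    obtain ⟨r₂, hr₂, δ₂, hδ₂, H₂⟩ := rt_stay (fun z => - V z) hV.neg y hρ₀
    have A : ∀ᶠ p : ℝ × (Fin n → ℝ) in 𝓝 (0, y), 
        (p.1 ∈ Ioo (-δ₂) δ₁) ∧ p.2 ∈ Metric.closedBall y r₁ ∩ Metric.closedBall y r₂ := by
      apply Filter.Eventually.prod_nhds (p := fun s => s ∈ Ioo (-δ₂) δ₁)
        (q := fun x => x ∈ Metric.closedBall y r₁ ∩ Metric.closedBall y r₂)
      · exact Ioo_mem_nhds (by linarith) hδ₁
      · exact inter_mem (Metric.closedBall_mem_nhds _ hr₁) (Metric.closedBall_mem_nhds _ hr₂)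
    filter_upwards [A]
    rintro ⟨s, x⟩ ⟨⟨hs1, hs2⟩, hx1, hx2⟩
    simp only [hφ0, id]
    rcases le_total 0 s with hs | hs
    · exact H₁ (fun s => φ s x) (hflow x) (by simpa [hφ0] using hx1) s ⟨hs, hs2.le⟩
    · have := H₂ (fun s => φ (-s) x) (fun t => by
        simpa [Function.comp_def] using (hflow x (-t)).scomp t (hasDerivAt_neg t)) (by simpa [hφ0] using hx2) (-s) 
        ⟨by linarith, by simp only at hs1; linarith⟩
      simpa using this
  rw [continuous_iff_continuousAt]
  rintro ⟨t, x⟩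
  have e : (fun p : ℝ × (Fin n → ℝ) => φ p.1 p.2) = 
      (fun p : ℝ × (Fin n → ℝ) => φ p.1 p.2) ∘ (fun p : ℝ × (Fin n → ℝ) => (p.1 - t, φ t p.2)) := by
    funext p
    have := congrFun (hgroup (p.1 - t) t) p.2
    simpa using this
  rw [e]
  apply ContinuousAt.comp
  · simpa using h0 (φ t x)
  · have := hcont t
    fun_prop

open Set Filter Topology in
theorem rt_fderiv0 {n : ℕ} (V : (Fin n → ℝ) → (Fin n → ℝ)) (φ : ℝ → (Fin n → ℝ) → (Fin n → ℝ))
    (hV : ContDiff ℝ 1 V)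
    (hflow : ∀ x t, HasDerivAt (fun s => φ s x) (V (φ t x)) t)
    (hφ0 : φ 0 = id)
    (hdiff : ∀ t, Differentiable ℝ (φ t)) (y : Fin n → ℝ) :
    HasDerivAt (fun s => fderiv ℝ (φ s) y) (fderiv ℝ V y) 0 := by
  have hA : HasStrictFDerivAt V (fderiv ℝ V y) y := hV.contDiffAt.hasStrictFDerivAt (by simp)
  set A := fderiv ℝ V y
  have hone : fderiv ℝ (φ 0) y = ContinuousLinearMap.id ℝ _ := by rw [hφ0]; exact fderiv_id
  have key : ∀ s C, 0 ≤ C → (∀ᶠ x in 𝓝 y, ‖φ s x - φ s y - (x - y) - s • A (x - y)‖ ≤ C * ‖x - y‖) →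
      ‖fderiv ℝ (φ s) y - ContinuousLinearMap.id ℝ _ - s • A‖ ≤ C := by
    intro s C hC h
    have hd : HasFDerivAt (fun x => φ s x - x - s • A x) 
        (fderiv ℝ (φ s) y - ContinuousLinearMap.id ℝ _ - s • A) y :=
      (((hdiff s y).hasFDerivAt).sub (hasFDerivAt_id y)).sub (A.hasFDerivAt.const_smul s)
    apply hd.le_of_lip' hC
    filter_upwards [h] with x hx
    have e : φ s x - x - s • A x - (φ s y - y - s • A y) =
        φ s x - φ s y - (x - y) - s • A (x - y) := by
      simp only [map_sub, smul_sub]; abel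
    rw [e]; exact hx
  rw [hasDerivAt_iff_isLittleO_nhds_zero, Asymptotics.isLittleO_iff]
  intro ε hε
  obtain ⟨r₁, hr₁, δ₁, hδ₁, H₁⟩ := rt_est V hV.continuous y A hA hε
  obtain ⟨r₂, hr₂, δ₂, hδ₂, H₂⟩ := rt_est (fun z => - V z) hV.continuous.neg y (-A) hA.neg hε
  filter_upwards [Ioo_mem_nhds (show -δ₂ < 0 by linarith) hδ₁] with s hs
  simp only [zero_add, hone]
  apply key _ _ (by positivity)
  filter_upwards [Metric.closedBall_mem_nhds y hr₁, Metric.closedBall_mem_nhds y hr₂] with x hx1 hx2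
  rcases le_total 0 s with h0 | h0
  · have := H₁ (fun s => φ s x) (fun s => φ s y) (hflow x) (hflow y) (by simpa [hφ0] using hx1)
      (by simp [hφ0, hr₁.le]) s ⟨h0, hs.2.le⟩
    simpa [hφ0, abs_of_nonneg h0] using this
  · have hr : ∀ z t, HasDerivAt (fun s => φ (-s) z) (-V (φ (-t) z)) t := fun z t => by
      simpa [Function.comp_def] using (hflow z (-t)).scomp t (hasDerivAt_neg t)
    have := H₂ (fun s => φ (-s) x) (fun s => φ (-s) y) (hr x) (hr y) (by simpa [hφ0] using hx2)
      (by simp [hφ0, hr₂.le]) (-s) ⟨by linarith, by linarith [hs.1]⟩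
    rw [Real.norm_eq_abs, abs_of_nonpos h0]
    simpa only [hφ0, neg_neg, neg_zero, id, neg_apply, smul_neg, neg_smul] using this

open Set Filter Topology in
theorem rt_K {n : ℕ} (V : (Fin n → ℝ) → (Fin n → ℝ)) (φ : ℝ → (Fin n → ℝ) → (Fin n → ℝ))
    (hV : ContDiff ℝ 1 V)
    (hflow : ∀ x t, HasDerivAt (fun s => φ s x) (V (φ t x)) t)
    (hφ0 : φ 0 = id)
    (hgroup : ∀ t s, φ (t + s) = φ t ∘ φ s)
    (hdiff : ∀ t, Differentiable ℝ (φ t)) (x : Fin n → ℝ) (t : ℝ) :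
    HasDerivAt (fun s => LinearMap.det (fderiv ℝ (φ s) x).toLinearMap)
      (LinearMap.trace ℝ (Fin n → ℝ) (fderiv ℝ V (φ t x)).toLinearMap * 
        LinearMap.det (fderiv ℝ (φ t) x).toLinearMap) t := by
  have h1 := rt_det _ _ (by rw [hφ0]; exact fderiv_id) 
    (rt_fderiv0 V φ hV hflow hφ0 hdiff (φ t x))
  have h2 := (HasDerivAt.comp_of_eq t h1 ((hasDerivAt_id t).sub_const t) (by simp)).mul_const 
    (LinearMap.det (fderiv ℝ (φ t) x).toLinearMap)
  rw [mul_one] at h2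
  refine h2.congr_of_eventuallyEq (Eventually.of_forall fun s => ?_)
  have : φ s = φ (s - t) ∘ φ t := by rw [← hgroup]; simp
  conv_lhs => beta_reduce; rw [this, fderiv_comp _ (hdiff _ _) (hdiff _ _)]
  simp [LinearMap.det_comp]

open Set Filter Topology in
theorem reynolds_transport_lagrangian {n : ℕ}
    (V : (Fin n → ℝ) → (Fin n → ℝ)) (φ : ℝ → (Fin n → ℝ) → (Fin n → ℝ))
    (hV : ContDiff ℝ 1 V)
    (hflow : ∀ x t, HasDerivAt (fun s => φ s x) (V (φ t x)) t)
    (hφ0 : φ 0 = id)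
    (hgroup : ∀ t s, φ (t + s) = φ t ∘ φ s)
    (hdiff : ∀ t, Differentiable ℝ (φ t))
    (T : (Fin n → ℝ) → ℝ → ℝ) (hT : ContDiff ℝ 1 (fun p : (Fin n → ℝ) × ℝ => T p.1 p.2))
    (W₀ : Set (Fin n → ℝ)) (hW₀ : MeasurableSet W₀) (hW₀b : Bornology.IsBounded W₀)
    (divV : (Fin n → ℝ) → ℝ)
    (hdiv : ∀ y, divV y = LinearMap.trace ℝ (Fin n → ℝ) ((fderiv ℝ V y).toLinearMap))
    (K : (Fin n → ℝ) → ℝ → ℝ)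
    (hK : ∀ x t, K x t = LinearMap.det ((fderiv ℝ (φ t) x).toLinearMap)) :
    ∀ t : ℝ,
      HasDerivAt (fun s => ∫ y in φ s '' W₀, T y s)
        (∫ x in W₀,
          (deriv (fun s => T (φ s x) s) t + T (φ t x) t * divV (φ t x)) * |K x t|) t := by
  intro t
  have hφc := rt_cont V φ hV.continuous hflow hφ0 hgroup (fun t => (hdiff t).continuous)
  have hφc' : Continuous (fun p : (Fin n → ℝ) × ℝ => φ p.2 p.1) := hφc.comp continuous_swap
  -- the divergence is continuous
  have hdivc : Continuous divV := by
    have h1 : Continuous (fderiv ℝ V) := hV.continuous_fderiv (by simp)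
    let l : ((Fin n → ℝ) →L[ℝ] (Fin n → ℝ)) →ₗ[ℝ] ℝ :=
      (LinearMap.trace ℝ (Fin n → ℝ)) ∘ₗ (ContinuousLinearMap.coeLM ℝ)
    have : divV = fun y => l (fderiv ℝ V y) := by funext y; rw [hdiv]; rfl
    rw [this]
    exact l.continuous_of_finiteDimensional.comp h1
  have hdivφ : Continuous (fun p : (Fin n → ℝ) × ℝ => divV (φ p.2 p.1)) := hdivc.comp hφc'
  have hKd : ∀ x t, HasDerivAt (K x) (divV (φ t x) * K x t) t := by
    intro x t
    have := rt_K V φ hV hflow hφ0 hgroup hdiff x t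
    rw [hdiv, hK]
    have e : K x = fun s => LinearMap.det (fderiv ℝ (φ s) x).toLinearMap := funext (hK x)
    rw [e]; exact this
  have hK0 : ∀ x, K x 0 = 1 := by
    intro x
    rw [hK, hφ0, fderiv_id]
    exact LinearMap.det_id
  -- explicit formula
  have hKexp : ∀ x t, K x t = Real.exp (∫ s in (0:ℝ)..t, divV (φ s x)) := by
    intro x t
    have hc : Continuous (fun s => divV (φ s x)) := 
      hdivφ.comp (by fun_prop : Continuous (fun s : ℝ => (x, s)))
    have hI : ∀ t, HasDerivAt (fun t => ∫ s in (0:ℝ)..t, divV (φ s x)) (divV (φ t x)) t := fun t =>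
      intervalIntegral.integral_hasDerivAt_right (hc.intervalIntegrable _ _) 
        (hc.stronglyMeasurableAtFilter _ _) hc.continuousAt
    have hg : ∀ t, HasDerivAt (fun t => K x t * Real.exp (-∫ s in (0:ℝ)..t, divV (φ s x))) 0 t := by
      intro t
      refine ((hKd x t).mul ((hI t).neg.exp)).congr_deriv ?_
      simp only [Pi.neg_apply]
      ring
    have := is_const_of_deriv_eq_zero (fun t => (hg t).differentiableAt) (fun t => (hg t).deriv) t 0
    simp only [intervalIntegral.integral_same, hK0, neg_zero, Real.exp_zero, mul_one] at this
    rw [Real.exp_neg] at this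
    field_simp at this
    exact this
  have hKpos : ∀ x t, 0 < K x t := fun x t => by rw [hKexp]; exact Real.exp_pos _
  have hKc : Continuous (fun p : (Fin n → ℝ) × ℝ => K p.1 p.2) := by
    simp only [hKexp]
    exact Real.continuous_exp.comp (intervalIntegral.continuous_parametric_primitive_of_continuous
      (f := fun x s => divV (φ s x)) hdivφ)
  -- derivative of T along the flow
  set T' : (Fin n → ℝ) → ℝ → ℝ := fun x t => 
    fderiv ℝ (fun p : (Fin n → ℝ) × ℝ => T p.1 p.2) (φ t x, t) (V (φ t x), 1) with hT'
  have hTd : ∀ x t, HasDerivAt (fun s => T (φ s x) s) (T' x t) t := by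
    intro x t
    have h1 := ((hT.differentiable (by simp)) (φ t x, t)).hasFDerivAt
    exact HasFDerivAt.comp_hasDerivAt (f := fun s => (φ s x, s)) t h1 ((hflow x t).prodMk (hasDerivAt_id t))
  have hφpair : Continuous (fun p : (Fin n → ℝ) × ℝ => (φ p.2 p.1, p.2)) := hφc'.prodMk continuous_snd
  have hTc : Continuous (fun p : (Fin n → ℝ) × ℝ => T (φ p.2 p.1) p.2) := hT.continuous.comp hφpair
  have hT'c : Continuous (fun p : (Fin n → ℝ) × ℝ => T' p.1 p.2) :=
    ((hT.continuous_fderiv (by simp)).comp hφpair).clm_apply 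
      ((hV.continuous.comp hφc').prodMk continuous_const)
  have hcv : (fun s => ∫ y in φ s '' W₀, T y s) = fun s => ∫ x in W₀, T (φ s x) s * K x s := by
    funext s
    have hinj : Function.Injective (φ s) := by
      have : Function.LeftInverse (φ (-s)) (φ s) := fun x => by
        have := congrFun (hgroup (-s) s) x
        simpa [hφ0] using this.symm
      exact this.injective
    rw [integral_image_eq_integral_abs_det_fderiv_smul volume hW₀ 
      (fun x _ => ((hdiff s x).hasFDerivAt).hasFDerivWithinAt) hinj.injOn]
    congr 1
    funext x
    have : (fderiv ℝ (φ s) x).det = K x s := (hK x s).symm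
    rw [this, abs_of_pos (hKpos x s), smul_eq_mul, mul_comm]
  rw [hcv]
  set F' : ℝ → (Fin n → ℝ) → ℝ := fun s x => (T' x s + T (φ s x) s * divV (φ s x)) * K x s with hF'
  have hF'c : Continuous (fun p : (Fin n → ℝ) × ℝ => F' p.2 p.1) :=
    (hT'c.add (hTc.mul hdivφ)).mul hKc
  have hFc : Continuous (fun p : (Fin n → ℝ) × ℝ => T (φ p.2 p.1) p.2 * K p.1 p.2) := hTc.mul hKc
  have hsl : ∀ s : ℝ, Continuous (fun x : Fin n → ℝ => (x, s)) := fun s => by fun_prop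
  have hcpt : IsCompact (closure W₀) := hW₀b.isCompact_closure
  obtain ⟨C, hC⟩ := (hcpt.prod (isCompact_Icc (a := t - 1) (b := t + 1))).exists_bound_of_continuousOn 
    hF'c.continuousOn
  have hfin : volume W₀ ≠ ⊤ := hW₀b.measure_lt_top.ne
  have main := hasDerivAt_integral_of_dominated_loc_of_deriv_le (μ := volume.restrict W₀)
    (F := fun s x => T (φ s x) s * K x s) (F' := F') (x₀ := t) (s := Icc (t - 1) (t + 1)) 
    (bound := fun _ => C)
    (Icc_mem_nhds (by linarith) (by linarith))
    (Eventually.of_forall fun s => (hFc.comp (hsl s)).aestronglyMeasurable)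
    (((hFc.comp (hsl t)).continuousOn.integrableOn_compact hcpt).mono_set subset_closure)
    (hF'c.comp (hsl t)).aestronglyMeasurable
    ((ae_restrict_iff' hW₀).2 (Eventually.of_forall fun x hx s hs => 
      hC (x, s) ⟨subset_closure hx, hs⟩))
    (integrableOn_const hfin)
    (Eventually.of_forall fun x s _ => by
      refine ((hTd x s).mul (hKd x s)).congr_deriv ?_
      simp only [F']; ring)
  refine main.2.congr_deriv ?_
  congr 1
  funext x
  rw [(hTd x t).deriv, abs_of_pos (hKpos x t)]
end

section
/- (Reynolds transport theorem, Eulerian form) With W(t) = φ(t)(W₀) a smoothly bounded moving region transported by the flow of V, d/dt ∫_{W(t)} T(y,t) dy = ∫_{W(t)} ∂ₜT(y,t) dy + ∫_{W(t)} div_y(T(y,t) V(y)) dy = ∫_{W(t)} ∂ₜT dy + ∫_{∂W(t)} T(y,t) ⟨V(y), n(y)⟩ ds(y). -/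
open MeasureTheory Matrix

namespace Reynolds

variable {E : Type*} [NormedAddCommGroup E] [NormedSpace ℝ E]

/-- Forward a priori bound for trajectories. -/
lemma stay_fwd {V : E → E} {c : ℝ → E} (hc : ∀ t, HasDerivAt c (V (c t)) t)
    {R M δ : ℝ} (hM : ∀ y ∈ Metric.closedBall (0 : E) (R + 1), ‖V y‖ ≤ M)
    (hM0 : 0 ≤ M) (hδ : (M + 1) * δ ≤ 1) (h0 : ‖c 0‖ ≤ R) {s : ℝ} (hs : 0 ≤ s) (hsδ : s ≤ δ) :
    ‖c s - c 0‖ ≤ (M + 1) * s := by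
  refine image_norm_le_of_norm_deriv_right_lt_deriv_boundary (f := fun s => c s - c 0)
    (f' := fun s => V (c s)) (a := 0) (b := δ) (B := fun s => (M + 1) * s)
    (B' := fun _ => M + 1) ?_ ?_ ?_ ?_ ?_ ⟨hs, hsδ⟩
  · exact (HasDerivAt.continuousOn (fun x _ => (hc x).sub_const _))
  · intro x _
    exact ((hc x).sub_const _).hasDerivWithinAt
  · simp
  · intro x
    simpa using (hasDerivAt_id x).const_mul (M + 1)
  · intro x hx he
    have : c x ∈ Metric.closedBall (0 : E) (R + 1) := by
      rw [mem_closedBall_zero_iff]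
      have h1 : ‖c x‖ ≤ ‖c x - c 0‖ + ‖c 0‖ := by
        simpa using norm_add_le (c x - c 0) (c 0)
      have h2 : (M + 1) * x ≤ (M + 1) * δ := by gcongr; exact hx.2.le
      linarith
    have := hM _ this
    linarith

lemma rev {V : E → E} {c : ℝ → E} (hc : ∀ t, HasDerivAt c (V (c t)) t) :
    ∀ t, HasDerivAt (fun s => c (-s)) ((fun y => - V y) (c (-t))) t := by
  intro t
  have := (hc (-t)).scomp t (hasDerivAt_neg t)
  simpa [Function.comp_def] using this

lemma stay {V : E → E} {c : ℝ → E} (hc : ∀ t, HasDerivAt c (V (c t)) t)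
    {R M δ : ℝ} (hM : ∀ y ∈ Metric.closedBall (0 : E) (R + 1), ‖V y‖ ≤ M)
    (hM0 : 0 ≤ M) (hδ : (M + 1) * δ ≤ 1) (h0 : ‖c 0‖ ≤ R) {s : ℝ} (hs : |s| ≤ δ) :
    ‖c s - c 0‖ ≤ (M + 1) * |s| := by
  rcases le_total 0 s with h | h
  · rw [abs_of_nonneg h] at *
    exact stay_fwd hc hM hM0 hδ h0 h hs
  · rw [abs_of_nonpos h] at *
    have := stay_fwd (V := fun y => - V y) (rev hc) (R := R) (M := M) (by simpa using hM) hM0 hδ (by simpa using h0)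
      (s := -s) (by linarith) hs
    simpa using this

lemma lip_fwd {V : E → E} {c d : ℝ → E} (hc : ∀ t, HasDerivAt c (V (c t)) t)
    (hd : ∀ t, HasDerivAt d (V (d t)) t) {K : Set E} {L : NNReal} (hV : LipschitzOnWith L V K)
    {δ : ℝ} (hcK : ∀ s, |s| ≤ δ → c s ∈ K) (hdK : ∀ s, |s| ≤ δ → d s ∈ K)
    {s : ℝ} (hs : 0 ≤ s) (hsδ : s ≤ δ) :
    ‖c s - d s‖ ≤ Real.exp (L * δ) * ‖c 0 - d 0‖ := by
  have := dist_le_of_trajectories_ODE_of_mem (v := fun _ => V) (s := fun _ => K) (f := c) (g := d)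
    (a := 0) (b := δ) (K := L) (fun _ _ => hV)
    (HasDerivAt.continuousOn (fun x _ => hc x)) (fun x _ => (hc x).hasDerivWithinAt)
    (fun x hx => hcK x (by rw [abs_of_nonneg hx.1]; exact hx.2.le))
    (HasDerivAt.continuousOn (fun x _ => hd x)) (fun x _ => (hd x).hasDerivWithinAt)
    (fun x hx => hdK x (by rw [abs_of_nonneg hx.1]; exact hx.2.le)) le_rfl s ⟨hs, hsδ⟩
  rw [dist_eq_norm, dist_eq_norm, mul_comm] at this
  refine this.trans ?_
  gcongr
  linarith

lemma lip {V : E → E} {c d : ℝ → E} (hc : ∀ t, HasDerivAt c (V (c t)) t)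
    (hd : ∀ t, HasDerivAt d (V (d t)) t) {K : Set E} {L : NNReal} (hV : LipschitzOnWith L V K)
    {δ : ℝ} (hcK : ∀ s, |s| ≤ δ → c s ∈ K) (hdK : ∀ s, |s| ≤ δ → d s ∈ K)
    {s : ℝ} (hs : |s| ≤ δ) :
    ‖c s - d s‖ ≤ Real.exp (L * δ) * ‖c 0 - d 0‖ := by
  rcases le_total 0 s with h | h
  · rw [abs_of_nonneg h] at *
    exact lip_fwd hc hd hV hcK hdK h hs
  · rw [abs_of_nonpos h] at *
    have := lip_fwd (rev hc) (rev hd) (K := K) (L := L) (δ := δ) (hV.neg)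
      (fun s hs => hcK _ (by simpa using hs)) (fun s hs => hdK _ (by simpa using hs))
      (s := -s) (by linarith) hs
    simpa using this

/-- Uniform short time estimates on balls. -/
lemma short [FiniteDimensional ℝ E] {V : E → E} (hV : ContDiff ℝ 1 V) {φ : ℝ → E → E}
    (hflow : ∀ x t, HasDerivAt (fun s => φ s x) (V (φ t x)) t) (hφ0 : φ 0 = id) (R : ℝ) :
    ∃ M L C δ : ℝ, 0 ≤ M ∧ 0 ≤ L ∧ 0 ≤ C ∧ 0 < δ ∧ (M + 1) * δ ≤ 1 ∧
      (∀ y ∈ Metric.closedBall (0 : E) (R + 1), ‖V y‖ ≤ M) ∧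
      (∀ y ∈ Metric.closedBall (0 : E) (R + 1), ‖fderiv ℝ V y‖ ≤ L) ∧
      (∀ x ∈ Metric.closedBall (0 : E) R, ∀ s, |s| ≤ δ → ‖φ s x - x‖ ≤ (M + 1) * |s|) ∧
      (∀ x ∈ Metric.closedBall (0 : E) R, ∀ s, |s| ≤ δ →
        φ s x ∈ Metric.closedBall (0 : E) (R + 1)) ∧
      (∀ x ∈ Metric.closedBall (0 : E) R, ∀ y ∈ Metric.closedBall (0 : E) R, ∀ s, |s| ≤ δ →
        ‖φ s x - φ s y‖ ≤ C * ‖x - y‖) ∧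
      (∀ x ∈ Metric.closedBall (0 : E) R, ∀ y ∈ Metric.closedBall (0 : E) R, ∀ s, |s| ≤ δ →
        ‖φ s x - φ s y - (x - y)‖ ≤ L * C * ‖x - y‖ * |s|) := by
  have hK : IsCompact (Metric.closedBall (0 : E) (R + 1)) := isCompact_closedBall _ _
  obtain ⟨M₀, hM₀⟩ := hK.exists_bound_of_continuousOn hV.continuous.continuousOn
  obtain ⟨L₀, hL₀⟩ := hK.exists_bound_of_continuousOn
    (hV.continuous_fderiv one_ne_zero).continuousOn
  set M := max M₀ 0
  set L : NNReal := Real.toNNReal L₀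
  have hM0 : 0 ≤ M := le_max_right _ _
  have hM : ∀ y ∈ Metric.closedBall (0 : E) (R + 1), ‖V y‖ ≤ M :=
    fun y hy => (hM₀ y hy).trans (le_max_left _ _)
  have hL : ∀ y ∈ Metric.closedBall (0 : E) (R + 1), ‖fderiv ℝ V y‖ ≤ L :=
    fun y hy => (hL₀ y hy).trans (Real.le_coe_toNNReal _)
  have hlipV : LipschitzOnWith L V (Metric.closedBall (0 : E) (R + 1)) :=
    (convex_closedBall _ _).lipschitzOnWith_of_nnnorm_fderiv_le
      (fun x _ => hV.differentiable one_ne_zero x) (fun x hx => hL x hx)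
  have hδ : (M + 1) * (1 / (M + 1)) ≤ 1 := by
    rw [mul_one_div_cancel]; positivity
  set δ := 1 / (M + 1)
  have hφ0' : ∀ x, φ 0 x = x := fun x => by simp [hφ0]
  have hstay : ∀ x ∈ Metric.closedBall (0 : E) R, ∀ s, |s| ≤ δ →
      ‖φ s x - x‖ ≤ (M + 1) * |s| := by
    intro x hx s hs
    have := stay (hflow x) hM hM0 hδ (by simpa [hφ0'] using hx) hs
    simpa [hφ0'] using this
  have hin : ∀ x ∈ Metric.closedBall (0 : E) R, ∀ s, |s| ≤ δ →
        φ s x ∈ Metric.closedBall (0 : E) (R + 1) := by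
    intro x hx s hs
    have h := hstay x hx s hs
    have h2 : (M + 1) * |s| ≤ (M + 1) * δ := by gcongr
    have h1 : ‖φ s x‖ ≤ ‖φ s x - x‖ + ‖x‖ := by
      simpa using norm_add_le (φ s x - x) x
    rw [mem_closedBall_zero_iff] at *
    linarith
  have hlip : ∀ x ∈ Metric.closedBall (0 : E) R, ∀ y ∈ Metric.closedBall (0 : E) R,
      ∀ s, |s| ≤ δ → ‖φ s x - φ s y‖ ≤ Real.exp (L * δ) * ‖x - y‖ := by
    intro x hx y hy s hs
    have := lip (hflow x) (hflow y) hlipV (hin x hx) (hin y hy) hs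
    simpa [hφ0'] using this
  refine ⟨M, L, Real.exp (L * δ), δ, hM0, L.2, by positivity, by positivity, hδ, hM, hL, hstay,
    hin, hlip, ?_⟩
  intro x hx y hy s hs
  have := Convex.norm_image_sub_le_of_norm_hasDerivWithin_le (f := fun s => φ s x - φ s y)
    (f' := fun s => V (φ s x) - V (φ s y)) (s := Set.Icc (-δ) δ) (x := 0) (y := s)
    (C := L * Real.exp (L * δ) * ‖x - y‖)
    (fun r _ => ((hflow x r).sub (hflow y r)).hasDerivWithinAt) ?_ (convex_Icc _ _) ?_ ?_
  · simpa [hφ0'] using this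
  · intro r hr
    have hr' : |r| ≤ δ := abs_le.2 hr
    refine (hlipV.norm_sub_le (hin x hx r hr') (hin y hy r hr')).trans ?_
    rw [mul_assoc]
    gcongr
    exact hlip x hx y hy r hr'
  · have : 0 < δ := by positivity
    constructor <;> linarith
  · exact abs_le.1 hs

/-- First order expansion of the flow, in a Lipschitz sense. -/
lemma expand [FiniteDimensional ℝ E] {V : E → E} (hV : ContDiff ℝ 1 V) {φ : ℝ → E → E}
    (hflow : ∀ x t, HasDerivAt (fun s => φ s x) (V (φ t x)) t) (hφ0 : φ 0 = id) (R : ℝ)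
    {ε : ℝ} (hε : 0 < ε) :
    ∃ δ > 0, ∀ h, |h| ≤ δ → ∀ x ∈ Metric.closedBall (0 : E) R, ∀ y ∈ Metric.closedBall (0 : E) R,
      ‖y - x‖ ≤ δ →
      ‖φ h y - φ h x - (y - x) - h • fderiv ℝ V x (y - x)‖ ≤ ε * |h| * ‖y - x‖ := by
  obtain ⟨M, L, C, δ, hM0, hL0, hC0, hδ0, hδ, hM, hL, hstay, hin, hlip, hlip2⟩ :=
    short hV hflow hφ0 R
  have hφ0' : ∀ x, φ 0 x = x := fun x => by simp [hφ0]
  have hK : IsCompact (Metric.closedBall (0 : E) (R + 1)) := isCompact_closedBall _ _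
  have huc := hK.uniformContinuousOn_of_continuous
    (hV.continuous_fderiv one_ne_zero).continuousOn
  rw [Metric.uniformContinuousOn_iff_le] at huc
  set ε₀ := ε / (2 * (C + 1))
  have hε₀ : 0 < ε₀ := by positivity
  obtain ⟨η, hη0, hη⟩ := huc ε₀ hε₀
  set δ₁ := η / (M + 2)
  set δ₂ := ε / (2 * (L * (L * C) + 1))
  have hδ₁ : (M + 2) * δ₁ = η := by simp only [δ₁]; field_simp
  have hδ₁0 : 0 < δ₁ := by positivity
  have hδ₂0 : 0 < δ₂ := by positivity
  refine ⟨min δ (min δ₁ δ₂), by positivity, ?_⟩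
  intro h hh x hx y hy hxy
  simp only [le_min_iff] at hh hxy
  have hRR : Metric.closedBall (0 : E) R ⊆ Metric.closedBall (0 : E) (R + 1) :=
    Metric.closedBall_subset_closedBall (by linarith)
  have := Convex.norm_image_sub_le_of_norm_hasDerivWithin_le
    (f := fun s => φ s y - φ s x - s • fderiv ℝ V x (y - x))
    (f' := fun s => V (φ s y) - V (φ s x) - (1 : ℝ) • fderiv ℝ V x (y - x))
    (s := Set.Icc (-|h|) |h|) (x := 0) (y := h)
    (C := ε * ‖y - x‖)
    (fun r _ => (((hflow y r).sub (hflow x r)).sub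
      ((hasDerivAt_id r).smul_const _)).hasDerivWithinAt) ?_ (convex_Icc _ _) ?_ ?_
  · simp only [hφ0', zero_smul, sub_zero] at this
    calc _ = ‖φ h y - φ h x - h • fderiv ℝ V x (y - x) - (y - x)‖ := by congr 1; abel
      _ ≤ _ := this
      _ = _ := by rw [Real.norm_eq_abs]; ring
  · intro r hr
    have hrh : |r| ≤ |h| := abs_le.2 hr
    have hrδ : |r| ≤ δ := hrh.trans hh.1
    set a := φ r y
    set b := φ r x
    have key : V a - V b - (1 : ℝ) • fderiv ℝ V x (y - x) =
        (V a - V b - fderiv ℝ V x (a - b)) + fderiv ℝ V x (a - b - (y - x)) := by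
      simp only [map_sub, one_smul]; abel
    rw [key]
    have hb : ‖b - x‖ ≤ (M + 1) * |r| := hstay x hx r hrδ
    have ha : ‖a - y‖ ≤ (M + 1) * |r| := hstay y hy r hrδ
    have hr1 : (M + 1) * |r| ≤ (M + 1) * δ₁ := by
      gcongr; exact hrh.trans hh.2.1
    set S := Metric.closedBall (0 : E) (R + 1) ∩ Metric.closedBall x η
    have hS : Convex ℝ S := (convex_closedBall _ _).inter (convex_closedBall _ _)
    have haS : a ∈ S := by
      refine ⟨hin y hy r hrδ, ?_⟩
      rw [Metric.mem_closedBall, dist_eq_norm]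
      have : ‖a - x‖ ≤ ‖a - y‖ + ‖y - x‖ := by simpa using norm_add_le (a - y) (y - x)
      linarith [hxy.2.1]
    have hbS : b ∈ S := by
      refine ⟨hin x hx r hrδ, ?_⟩
      rw [Metric.mem_closedBall, dist_eq_norm]
      linarith [hxy.2.1]
    have e1 : ‖V a - V b - fderiv ℝ V x (a - b)‖ ≤ ε₀ * ‖a - b‖ := by
      refine Convex.norm_image_sub_le_of_norm_fderiv_le' (𝕜 := ℝ)
        (fun z _ => hV.differentiable one_ne_zero z) (fun z hz => ?_) hS hbS haS
      rw [← dist_eq_norm]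
      exact hη z hz.1 x (hRR hx) hz.2
    have e2 : ‖fderiv ℝ V x (a - b - (y - x))‖ ≤ L * (L * C * ‖y - x‖ * |r|) := by
      refine (ContinuousLinearMap.le_opNorm _ _).trans ?_
      gcongr
      · exact hL x (hRR hx)
      · exact hlip2 y hy x hx r hrδ
    have e3 : ‖a - b‖ ≤ C * ‖y - x‖ := hlip y hy x hx r hrδ
    have e4 : ε₀ * C ≤ ε / 2 := by
      simp only [ε₀]
      rw [div_mul_eq_mul_div, div_le_div_iff₀ (by positivity) (by positivity)]
      nlinarith
    have e5 : L * (L * C) * |r| ≤ ε / 2 := by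
      have : L * (L * C) * |r| ≤ (L * (L * C) + 1) * δ₂ := by
        gcongr
        · linarith
        · exact hrh.trans hh.2.2
      refine this.trans (le_of_eq ?_)
      simp only [δ₂]
      field_simp
    calc _ ≤ ε₀ * ‖a - b‖ + L * (L * C * ‖y - x‖ * |r|) := (norm_add_le _ _).trans (add_le_add e1 e2)
      _ ≤ ε₀ * (C * ‖y - x‖) + L * (L * C * ‖y - x‖ * |r|) := by gcongr
      _ = (ε₀ * C + L * (L * C) * |r|) * ‖y - x‖ := by ring
      _ ≤ (ε / 2 + ε / 2) * ‖y - x‖ := by gcongr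
      _ = _ := by ring
  · constructor <;> simp
  · exact abs_le.1 le_rfl

lemma fderiv_bound [FiniteDimensional ℝ E] {V : E → E} (hV : ContDiff ℝ 1 V) {φ : ℝ → E → E}
    (hflow : ∀ x t, HasDerivAt (fun s => φ s x) (V (φ t x)) t) (hφ0 : φ 0 = id) (R : ℝ)
    {ε : ℝ} (hε : 0 < ε) :
    ∃ δ > 0, ∀ h, |h| ≤ δ → ∀ x ∈ Metric.ball (0 : E) R, DifferentiableAt ℝ (φ h) x →
      ‖fderiv ℝ (φ h) x - ContinuousLinearMap.id ℝ E - h • fderiv ℝ V x‖ ≤ ε * |h| := by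
  obtain ⟨δ, hδ, H⟩ := expand hV hflow hφ0 R hε
  refine ⟨δ, hδ, fun h hh x hx hd => ?_⟩
  have h1 : HasFDerivAt (fun y => φ h y - y - h • fderiv ℝ V x y)
      (fderiv ℝ (φ h) x - ContinuousLinearMap.id ℝ E - h • fderiv ℝ V x) x :=
    (hd.hasFDerivAt.sub (hasFDerivAt_id x)).sub ((fderiv ℝ V x).hasFDerivAt.const_smul h)
  refine h1.le_of_lip' (by positivity) ?_
  filter_upwards [Metric.isOpen_ball.mem_nhds hx, Metric.closedBall_mem_nhds x hδ] with y hy hy2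
  have := H h hh x (Metric.ball_subset_closedBall hx) y (Metric.ball_subset_closedBall hy)
    (by rwa [← dist_eq_norm])
  convert! this using 2
  simp only [map_sub, smul_sub]
  abel

lemma flow_continuous [FiniteDimensional ℝ E] {V : E → E} (hV : ContDiff ℝ 1 V) {φ : ℝ → E → E}
    (hflow : ∀ x t, HasDerivAt (fun s => φ s x) (V (φ t x)) t) (hφ0 : φ 0 = id)
    (hgroup : ∀ t s, φ (t + s) = φ t ∘ φ s) (t : ℝ) : Continuous (φ t) := by
  rw [continuous_iff_continuousAt]
  intro x
  have hc : Continuous (fun s => φ s x) :=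
    continuous_iff_continuousAt.2 fun s => (hflow x s).continuousAt
  obtain ⟨R, hR⟩ := (isCompact_Icc (a := -|t|) (b := |t|)).exists_bound_of_continuousOn
    hc.continuousOn
  obtain ⟨M, L, C, δ, hM0, hL0, hC0, hδ0, hδ, hM, hL, hstay, hin, hlip, hlip2⟩ :=
    short hV hflow hφ0 (R + 1)
  obtain ⟨N, hN⟩ := exists_nat_gt (|t| / δ)
  have hN0 : (0 : ℝ) < N := lt_of_le_of_lt (by positivity) hN
  have hτ : |t / N| ≤ δ := by
    rw [abs_div, abs_of_pos hN0, div_le_iff₀ hN0]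
    rw [div_lt_iff₀ hδ0] at hN
    linarith
  have step : ∀ k : ℕ, k ≤ N → ContinuousAt (φ (k * (t / N))) x := by
    intro k
    induction k with
    | zero => intro _; simp [hφ0, continuousAt_id]
    | succ k ih =>
      intro hk
      have e : ((k + 1 : ℕ) : ℝ) * (t / N) = t / N + k * (t / N) := by push_cast; ring
      rw [e, hgroup]
      refine ContinuousAt.comp ?_ (ih (by omega))
      have hmem : φ (k * (t / N)) x ∈ Metric.ball (0 : E) (R + 1) := by
        rw [mem_ball_zero_iff]
        have := hR (k * (t / N)) (by
          rw [Set.mem_Icc, ← abs_le, abs_mul, abs_div, Nat.abs_cast, Nat.abs_cast,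
            ← mul_div_assoc, div_le_iff₀ hN0, mul_comm]
          gcongr
          omega)
        linarith
      have hl : LipschitzOnWith (Real.toNNReal C) (φ (t / N)) (Metric.ball (0 : E) (R + 1)) := by
        refine LipschitzOnWith.of_dist_le_mul fun a ha b hb => ?_
        rw [dist_eq_norm, dist_eq_norm, Real.coe_toNNReal _ hC0]
        exact hlip a (Metric.ball_subset_closedBall ha) b (Metric.ball_subset_closedBall hb) _ hτ
      exact hl.continuousOn.continuousAt (Metric.isOpen_ball.mem_nhds hmem)
  have := step N le_rfl
  rwa [mul_div_cancel₀ _ hN0.ne'] at this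


/-- The trace as a continuous linear functional. -/
noncomputable def ctr (n : ℕ) : ((Fin n → ℝ) →L[ℝ] (Fin n → ℝ)) →L[ℝ] ℝ :=
  LinearMap.toContinuousLinearMap
    ((LinearMap.trace ℝ (Fin n → ℝ)) ∘ₗ (ContinuousLinearMap.coeLM ℝ))

lemma ctr_apply {n : ℕ} (B : (Fin n → ℝ) →L[ℝ] (Fin n → ℝ)) :
    ctr n B = LinearMap.trace ℝ (Fin n → ℝ) B.toLinearMap := rfl

lemma det_eq {n : ℕ} (B : (Fin n → ℝ) →L[ℝ] (Fin n → ℝ)) :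
    B.det = (LinearMap.toMatrix' B.toLinearMap).det := by
  rw [LinearMap.det_toMatrix']

lemma det_differentiable (n : ℕ) :
    Differentiable ℝ (fun B : (Fin n → ℝ) →L[ℝ] (Fin n → ℝ) => B.det) := by
  have : (fun B : (Fin n → ℝ) →L[ℝ] (Fin n → ℝ) => B.det) = fun B =>
      ∑ σ : Equiv.Perm (Fin n), ((Equiv.Perm.sign σ : ℤ) : ℝ) *
        ∏ i, B (Pi.single i 1) (σ i) := by
    ext B
    rw [det_eq, Matrix.det_apply']
    simp [LinearMap.toMatrix'_apply]
  rw [this]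
  have h : ∀ i j : Fin n, Differentiable ℝ
      (fun B : (Fin n → ℝ) →L[ℝ] (Fin n → ℝ) => B (Pi.single i 1) j) := by
    intro i j
    exact ((ContinuousLinearMap.proj (R := ℝ) (φ := fun _ : Fin n => ℝ) j).comp
      (ContinuousLinearMap.apply ℝ (Fin n → ℝ) (Pi.single i 1 : Fin n → ℝ))).differentiable
  fun_prop

lemma det_hasFDerivAt (n : ℕ) :
    HasFDerivAt (fun B : (Fin n → ℝ) →L[ℝ] (Fin n → ℝ) => B.det) (ctr n)
      (ContinuousLinearMap.id ℝ (Fin n → ℝ)) := by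
  have h := (det_differentiable n (ContinuousLinearMap.id ℝ (Fin n → ℝ))).hasFDerivAt
  convert h using 1
  ext B
  have h1 : HasDerivAt (fun r : ℝ => ContinuousLinearMap.id ℝ (Fin n → ℝ) + r • B) B 0 := by
    simpa using ((hasDerivAt_id (0 : ℝ)).smul_const B).const_add
      (ContinuousLinearMap.id ℝ (Fin n → ℝ))
  have h2 := HasFDerivAt.comp_hasDerivAt_of_eq (0 : ℝ) h h1 (by simp)
  set A := LinearMap.toMatrix' B.toLinearMap with hA
  have h3 : HasDerivAt (fun r : ℝ => (1 + r • A).det) A.trace 0 := by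
    rw [funext fun r => Matrix.det_one_add_smul r A]
    have p := (((1 : Matrix (Fin n) (Fin n) (Polynomial ℝ)) +
      (Polynomial.X : Polynomial ℝ) • A.map Polynomial.C).det).divX.divX.hasDerivAt (0 : ℝ)
    have := (((hasDerivAt_id (0 : ℝ)).const_mul A.trace).const_add 1).add
      (p.mul ((hasDerivAt_id (0 : ℝ)).pow 2))
    convert! this using 1
    simp
  have e : (fun B : (Fin n → ℝ) →L[ℝ] (Fin n → ℝ) => B.det) ∘
      (fun r : ℝ => ContinuousLinearMap.id ℝ (Fin n → ℝ) + r • B) =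
      fun r : ℝ => (1 + r • A).det := by
    ext r
    simp only [Function.comp, det_eq]
    congr 1
    simp [hA]
  rw [e] at h2
  rw [h2.unique h3, ctr_apply, LinearMap.trace_eq_matrix_trace ℝ (Pi.basisFun ℝ (Fin n)), hA,
    LinearMap.toMatrix_eq_toMatrix']

lemma jac_bound {n : ℕ} {V : (Fin n → ℝ) → (Fin n → ℝ)} (hV : ContDiff ℝ 1 V)
    {φ : ℝ → (Fin n → ℝ) → (Fin n → ℝ)}
    (hflow : ∀ x t, HasDerivAt (fun s => φ s x) (V (φ t x)) t) (hφ0 : φ 0 = id) (R : ℝ)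
    {ε : ℝ} (hε : 0 < ε) :
    ∃ δ > 0, ∀ h, |h| ≤ δ → ∀ x ∈ Metric.ball (0 : Fin n → ℝ) R, DifferentiableAt ℝ (φ h) x →
      ‖|(fderiv ℝ (φ h) x).det| - (1 + h * ctr n (fderiv ℝ V x))‖ ≤ ε * |h| := by
  obtain ⟨M, L, C, δ₀, hM0, hL0, hC0, hδ0, hδ, hM, hL, -⟩ := short hV hflow hφ0 R
  set I := ContinuousLinearMap.id ℝ (Fin n → ℝ)
  have hdet := (hasFDerivAt_iff_isLittleO_nhds_zero.1 (det_hasFDerivAt n)).def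
    (c := ε / (2 * (L + 1))) (by positivity)
  obtain ⟨η, hη, hdet⟩ := Metric.eventually_nhds_iff_ball.1 hdet
  have hcont := (det_differentiable n).continuous.continuousAt (x := I)
  have hpos : ∀ᶠ B in nhds I, 0 < B.det := by
    refine hcont.eventually (lt_mem_nhds ?_)
    simp [I, ContinuousLinearMap.det]
  obtain ⟨η', hη', hpos⟩ := Metric.eventually_nhds_iff_ball.1 hpos
  set t := ‖ctr n‖
  obtain ⟨δ₁, hδ₁, H⟩ := fderiv_bound hV hflow hφ0 R (ε := min 1 (ε / (2 * (t + 1))))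
    (by positivity)
  refine ⟨min δ₁ (min (η / (2 * (L + 1))) (η' / (2 * (L + 1)))), by positivity, ?_⟩
  intro h hh x hx hd
  simp only [le_min_iff] at hh
  have hb := H h hh.1 x hx hd
  set D := fderiv ℝ (φ h) x
  have hx1 : x ∈ Metric.closedBall (0 : Fin n → ℝ) (R + 1) :=
    Metric.closedBall_subset_closedBall (by linarith) (Metric.ball_subset_closedBall hx)
  have hDI : ‖D - I‖ ≤ (L + 1) * |h| := by
    have e : D - I = (D - I - h • fderiv ℝ V x) + h • fderiv ℝ V x := by abel
    rw [e]
    refine (norm_add_le _ _).trans ?_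
    have : ‖h • fderiv ℝ V x‖ ≤ |h| * L := by
      rw [norm_smul, Real.norm_eq_abs]; gcongr; exact hL x hx1
    have h2 : min 1 (ε / (2 * (t + 1))) * |h| ≤ 1 * |h| := by gcongr; exact min_le_left _ _
    linarith
  have small : ∀ {q : ℝ}, 0 < q → |h| ≤ q / (2 * (L + 1)) → ‖D - I‖ < q := by
    intro q hq hle
    rw [le_div_iff₀ (by positivity)] at hle
    nlinarith
  have hp : 0 < D.det := hpos D (by rw [Metric.mem_ball, dist_eq_norm]; exact small hη' hh.2.2)
  rw [abs_of_pos hp]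
  have h1 := hdet (D - I) (by rw [mem_ball_zero_iff]; exact small hη hh.2.1)
  have hI : I.det = 1 := by simp [I, ContinuousLinearMap.det]
  rw [add_sub_cancel, hI] at h1
  have h2 : ‖ctr n (D - I - h • fderiv ℝ V x)‖ ≤ t * (min 1 (ε / (2 * (t + 1))) * |h|) := by
    refine ((ctr n).le_opNorm _).trans ?_
    gcongr
  have e : D.det - (1 + h * ctr n (fderiv ℝ V x)) =
      (D.det - 1 - ctr n (D - I)) + ctr n (D - I - h • fderiv ℝ V x) := by
    simp only [map_sub, map_smul, smul_eq_mul]; ring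
  rw [e]
  have h3 : ε / (2 * (L + 1)) * ‖D - I‖ ≤ ε / 2 * |h| := by
    calc _ ≤ ε / (2 * (L + 1)) * ((L + 1) * |h|) := by gcongr
      _ = _ := by field_simp
  have h4 : t * (min 1 (ε / (2 * (t + 1))) * |h|) ≤ ε / 2 * |h| := by
    calc _ ≤ (t + 1) * (ε / (2 * (t + 1)) * |h|) := by
          gcongr
          · linarith
          · exact min_le_right _ _
      _ = _ := by
        have : t + 1 ≠ 0 := by positivity
        field_simp
  have := norm_add_le (D.det - 1 - ctr n (D - I)) (ctr n (D - I - h • fderiv ℝ V x))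
  linarith

/-- Change of variables for injective Lipschitz maps. -/
lemma cov {n : ℕ} {W : Set (Fin n → ℝ)} (hW : IsOpen W) {ψ : (Fin n → ℝ) → (Fin n → ℝ)}
    {C : NNReal} (hl : LipschitzOnWith C ψ W) (hinj : Set.InjOn ψ W) (g : (Fin n → ℝ) → ℝ) :
    (∀ᵐ x ∂(volume.restrict W), DifferentiableAt ℝ ψ x) ∧
    ∫ y in ψ '' W, g y = ∫ x in W, |(fderiv ℝ ψ x).det| * g (ψ x) := by
  have hae : ∀ᵐ x ∂(volume.restrict W), DifferentiableAt ℝ ψ x := by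
    rw [ae_restrict_iff' hW.measurableSet]
    filter_upwards [hl.ae_differentiableWithinAt_of_mem (μ := volume)] with x hx hxW
    exact (hx hxW).differentiableAt (hW.mem_nhds hxW)
  refine ⟨hae, ?_⟩
  set S := W ∩ {x | DifferentiableAt ℝ ψ x}
  have hS : MeasurableSet S := hW.measurableSet.inter (measurableSet_of_differentiableAt ℝ ψ)
  have hnull : volume (W \ S) = 0 := by
    rw [ae_restrict_iff' hW.measurableSet] at hae
    refine measure_mono_null ?_ hae
    intro x hx
    simp only [Set.mem_compl_iff, Set.mem_ofPred_eq]
    intro h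
    exact hx.2 ⟨hx.1, h hx.1⟩
  have hnull2 : volume (ψ '' (W \ S)) = 0 := by
    rw [← hausdorffMeasure_pi_real] at hnull ⊢
    have := (hl.mono (Set.sdiff_subset (t := S))).hausdorffMeasure_image_le
      (d := (Fintype.card (Fin n) : ℝ)) (by positivity)
    rw [hnull, mul_zero] at this
    exact le_antisymm this bot_le
  have hSW : S ⊆ W := Set.inter_subset_left
  have e1 : (ψ '' W : Set _) =ᵐ[volume] (ψ '' S : Set _) := by
    have : ψ '' W = ψ '' S ∪ ψ '' (W \ S) := by
      rw [← Set.image_union, Set.union_sdiff_cancel hSW]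
    rw [this]
    exact union_ae_eq_left_of_ae_eq_empty (ae_eq_empty.2 hnull2)
  have e2 : (W : Set _) =ᵐ[volume] (S : Set _) := by
    have : W = S ∪ (W \ S) := (Set.union_sdiff_cancel hSW).symm
    conv_lhs => rw [this]
    exact union_ae_eq_left_of_ae_eq_empty (ae_eq_empty.2 hnull)
  rw [setIntegral_congr_set e1, setIntegral_congr_set e2]
  exact integral_image_eq_integral_abs_det_fderiv_smul volume hS
    (fun x hx => hx.2.hasFDerivAt.hasFDerivWithinAt) (hinj.mono hSW) g


lemma core {n : ℕ} {V : (Fin n → ℝ) → (Fin n → ℝ)} (hV : ContDiff ℝ 1 V)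
    {φ : ℝ → (Fin n → ℝ) → (Fin n → ℝ)}
    (hflow : ∀ x t, HasDerivAt (fun s => φ s x) (V (φ t x)) t) (hφ0 : φ 0 = id)
    (hgroup : ∀ t s, φ (t + s) = φ t ∘ φ s)
    {g : (Fin n → ℝ) × ℝ → ℝ} (hg : ContDiff ℝ 1 g)
    {W : Set (Fin n → ℝ)} (hW : IsOpen W) (hWb : Bornology.IsBounded W) :
    HasDerivAt (fun h => ∫ y in φ h '' W, g (y, h))
      (∫ x in W, (ctr n (fderiv ℝ V x) * g (x, 0) + fderiv ℝ g (x, 0) (V x, 1))) 0 := by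
  obtain ⟨R, hR⟩ := hWb.subset_ball 0
  obtain ⟨M, L, C, δ, hM0, hL0, hC0, hδ0, hδ, hM, hL, hstay, hin, hlip, hlip2⟩ :=
    short hV hflow hφ0 R
  have hφc := flow_continuous hV hflow hφ0 hgroup
  have hφ0' : ∀ x, φ 0 x = x := fun x => by simp [hφ0]
  have hWc : ∀ x ∈ W, x ∈ Metric.closedBall (0 : Fin n → ℝ) R :=
    fun x hx => Metric.ball_subset_closedBall (hR hx)
  have hWfin : volume W < ⊤ := hWb.measure_lt_top
  have : IsFiniteMeasure (volume.restrict W) := ⟨by simpa using hWfin⟩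
  have hgc := hg.continuous
  have hDg : Continuous (fderiv ℝ g) := hg.continuous_fderiv one_ne_zero
  have hτc : Continuous (fun x => ctr n (fderiv ℝ V x)) :=
    (ctr n).continuous.comp (hV.continuous_fderiv one_ne_zero)
  set τ : (Fin n → ℝ) → ℝ := fun x => ctr n (fderiv ℝ V x)
  have hK : IsCompact (Metric.closedBall (0 : Fin n → ℝ) (R + 1)) := isCompact_closedBall _ _
  have hKI := hK.prod (isCompact_Icc (a := -δ) (b := δ))
  obtain ⟨G, hG⟩ := hKI.exists_bound_of_continuousOn hgc.continuousOn
  obtain ⟨G', hG'⟩ := hKI.exists_bound_of_continuousOn hDg.continuousOn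
  obtain ⟨Q, hQ⟩ := hK.exists_bound_of_continuousOn hτc.continuousOn
  have hRR : Metric.closedBall (0 : Fin n → ℝ) R ⊆ Metric.closedBall (0 : Fin n → ℝ) (R + 1) :=
    Metric.closedBall_subset_closedBall (by linarith)
  have hmem : ∀ x ∈ W, ∀ h, |h| ≤ δ →
      (φ h x, h) ∈ Metric.closedBall (0 : Fin n → ℝ) (R + 1) ×ˢ Set.Icc (-δ) δ :=
    fun x hx h hh => ⟨hin x (hWc x hx) h hh, abs_le.1 hh⟩
  -- the comparison function
  have hB : HasDerivAt (fun h => ∫ x in W, (1 + h * τ x) * g (φ h x, h))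
      (∫ x in W, (τ x * g (φ 0 x, 0) +
        (1 + 0 * τ x) * fderiv ℝ g (φ 0 x, 0) (V (φ 0 x), 1))) 0 := by
    refine (hasDerivAt_integral_of_dominated_loc_of_deriv_le (μ := volume.restrict W)
      (F := fun h x => (1 + h * τ x) * g (φ h x, h))
      (F' := fun h x => τ x * g (φ h x, h) +
        (1 + h * τ x) * fderiv ℝ g (φ h x, h) (V (φ h x), 1))
      (bound := fun _ => Q * G + (1 + δ * Q) * (G' * max M 1))
      (s := Metric.closedBall 0 δ) (Metric.closedBall_mem_nhds _ hδ0) ?_ ?_ ?_ ?_ ?_ ?_).2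
    · refine Filter.Eventually.of_forall fun h => Continuous.aestronglyMeasurable ?_
      have := hφc h
      fun_prop
    · refine Measure.integrableOn_of_bounded (M := G) hWfin.ne ?_ ?_
      · refine Continuous.aestronglyMeasurable ?_
        have := hφc 0
        fun_prop
      · rw [ae_restrict_iff' hW.measurableSet]
        refine Filter.Eventually.of_forall fun x hx => ?_
        have := hG _ (hmem x hx 0 (by simpa using hδ0.le))
        simpa using this
    · refine Continuous.aestronglyMeasurable ?_
      have := hφc 0
      have := hV.continuous
      fun_prop
    · rw [ae_restrict_iff' hW.measurableSet]
      refine Filter.Eventually.of_forall fun x hx h hh => ?_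
      have hh' : |h| ≤ δ := by simpa using hh
      have h1 := hG _ (hmem x hx h hh')
      have h2 := hG' _ (hmem x hx h hh')
      have h3 := hQ x (hRR (hWc x hx))
      have h4 := hM _ (hin x (hWc x hx) h hh')
      have hQ0 : 0 ≤ Q := (norm_nonneg _).trans h3
      have hG'0 : 0 ≤ G' := (norm_nonneg _).trans h2
      have h5 : ‖fderiv ℝ g (φ h x, h) (V (φ h x), 1)‖ ≤ G' * max M 1 := by
        refine (ContinuousLinearMap.le_opNorm _ _).trans ?_
        gcongr
        rw [Prod.norm_mk]
        exact max_le_max h4 (by simp)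
      have h6 : ‖1 + h * τ x‖ ≤ 1 + δ * Q := by
        refine (norm_add_le _ _).trans ?_
        rw [norm_one, norm_mul, Real.norm_eq_abs]
        gcongr
      refine (norm_add_le _ _).trans ?_
      rw [norm_mul, norm_mul]
      gcongr
    · exact integrable_const _
    · refine Filter.Eventually.of_forall fun x h hh => ?_
      have d1 : HasDerivAt (fun h => (φ h x, h)) (V (φ h x), (1 : ℝ)) h :=
        (hflow x h).prodMk (hasDerivAt_id h)
      have d2 := HasFDerivAt.comp_hasDerivAt (f := fun h => (φ h x, h)) h
        ((hg.differentiable one_ne_zero (φ h x, h)).hasFDerivAt) d1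
      have d3 : HasDerivAt (fun h => 1 + h * τ x) (τ x) h := by
        simpa using ((hasDerivAt_id h).mul_const (τ x)).const_add 1
      exact d3.mul d2
  -- the difference is `o(h)`
  have hdiff : HasDerivAt (fun h => (∫ y in φ h '' W, g (y, h)) -
      ∫ x in W, (1 + h * τ x) * g (φ h x, h)) 0 0 := by
    have est : ∀ ε > 0, ∃ δ' > 0, ∀ h, |h| ≤ δ' → ‖(∫ y in φ h '' W, g (y, h)) -
        ∫ x in W, (1 + h * τ x) * g (φ h x, h)‖ ≤ ε * |h| := by
      intro ε hε
      set v := volume.real W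
      obtain ⟨δ₁, hδ₁, H⟩ := jac_bound hV hflow hφ0 R (ε := ε / ((|G| + 1) * (v + 1)))
        (by positivity)
      refine ⟨min δ δ₁, by positivity, fun h hh => ?_⟩
      simp only [le_min_iff] at hh
      have hl : LipschitzOnWith (Real.toNNReal C) (φ h) W := by
        refine LipschitzOnWith.of_dist_le_mul fun a ha b hb => ?_
        rw [dist_eq_norm, dist_eq_norm, Real.coe_toNNReal _ hC0]
        exact hlip a (hWc a ha) b (hWc b hb) _ hh.1
      have hinj : Set.InjOn (φ h) W := by
        refine Function.Injective.injOn ?_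
        refine Function.LeftInverse.injective (g := φ (-h)) fun x => ?_
        have := congrFun (hgroup (-h) h) x
        simpa [hφ0] using this.symm
      obtain ⟨hae, hcov⟩ := cov hW hl hinj (fun y => g (y, h))
      rw [hcov]
      have hJ : ∀ᵐ x ∂(volume.restrict W),
          ‖|(fderiv ℝ (φ h) x).det| - (1 + h * τ x)‖ ≤ ε / ((|G| + 1) * (v + 1)) * |h| := by
        filter_upwards [hae, ae_restrict_mem hW.measurableSet] with x hx hxW
        exact H h hh.2 x (hR hxW) hx
      have hbd : ∀ᵐ x ∂(volume.restrict W),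
          ‖|(fderiv ℝ (φ h) x).det| * g (φ h x, h) - (1 + h * τ x) * g (φ h x, h)‖ ≤
            ε / (v + 1) * |h| := by
        filter_upwards [hJ, ae_restrict_mem hW.measurableSet] with x hx hxW
        rw [← sub_mul, norm_mul]
        have h1 : ‖g (φ h x, h)‖ ≤ |G| + 1 :=
          (hG _ (hmem x hxW h hh.1)).trans (by linarith [le_abs_self G])
        calc _ ≤ ε / ((|G| + 1) * (v + 1)) * |h| * (|G| + 1) := by gcongr
          _ = _ := by field_simp
      have hi2 : Integrable (fun x => (1 + h * τ x) * g (φ h x, h)) (volume.restrict W) := by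
        have hc : Continuous (fun x => (1 + h * τ x) * g (φ h x, h)) := by
          have := hφc h
          fun_prop
        exact (hc.continuousOn.integrableOn_compact (isCompact_closedBall 0 R)).mono_set hWc
      have hm : Measurable (fun x => |(fderiv ℝ (φ h) x).det|) :=
        ((det_differentiable n).continuous.measurable.comp (measurable_fderiv ℝ (φ h))).abs
      have hm2 : Measurable (fun x => g (φ h x, h)) := by
        have := hφc h
        exact Continuous.measurable (by fun_prop)
      have hi3 : Integrable (fun x => |(fderiv ℝ (φ h) x).det| * g (φ h x, h) -
          (1 + h * τ x) * g (φ h x, h)) (volume.restrict W) :=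
        Integrable.of_bound ((hm.mul hm2).aestronglyMeasurable.sub hi2.aestronglyMeasurable) _ hbd
      have hi1 : Integrable (fun x => |(fderiv ℝ (φ h) x).det| * g (φ h x, h))
          (volume.restrict W) := by
        refine (hi3.add hi2).congr (Filter.Eventually.of_forall fun x => ?_)
        simp
      rw [← integral_sub hi1 hi2]
      refine (norm_integral_le_of_norm_le_const hbd).trans ?_
      rw [measureReal_restrict_apply_univ]
      have : v ≤ v + 1 := by linarith
      calc _ ≤ ε / (v + 1) * |h| * (v + 1) := by gcongr
        _ = _ := by
          have : v + 1 ≠ 0 := by positivity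
          field_simp
    rw [hasDerivAt_iff_isLittleO, Asymptotics.isLittleO_iff]
    intro ε hε
    obtain ⟨δ', hδ', H⟩ := est ε hε
    filter_upwards [Metric.closedBall_mem_nhds (0 : ℝ) hδ'] with h hh
    have h0 := H 0 (by simpa using hδ'.le)
    simp only [abs_zero, mul_zero, norm_le_zero_iff] at h0
    rw [h0]
    simpa using H h (by simpa using hh)
  have := hdiff.add hB
  simp only [hφ0', zero_mul, add_zero, one_mul, zero_add] at this
  convert! this using 1
  ext h
  simp

end Reynolds

/-- Reynolds transport theorem, Eulerian form: for the moving region W(t) = φ(t)W₀,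
d/dt ∫_{W(t)} T dy = ∫_{W(t)} ∂ₜT dy + ∫_{W(t)} div(T V) dy
                   = ∫_{W(t)} ∂ₜT dy + ∫_{∂W(t)} T ⟨V,n⟩ ds,
the last equality being the divergence theorem (σ t is the surface measure on
∂W(t) and ν t the outward unit normal). -/
theorem reynolds_transport_eulerian {n : ℕ}
    (V : (Fin n → ℝ) → (Fin n → ℝ)) (φ : ℝ → (Fin n → ℝ) → (Fin n → ℝ))
    (hV : ContDiff ℝ 1 V)
    (hflow : ∀ x t, HasDerivAt (fun s => φ s x) (V (φ t x)) t)
    (hφ0 : φ 0 = id)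
    (hgroup : ∀ t s, φ (t + s) = φ t ∘ φ s)
    (T : (Fin n → ℝ) → ℝ → ℝ) (hT : ContDiff ℝ 1 (fun p : (Fin n → ℝ) × ℝ => T p.1 p.2))
    (W₀ : Set (Fin n → ℝ)) (hW₀ : IsOpen W₀) (hW₀b : Bornology.IsBounded W₀)
    (σ : ℝ → Measure (Fin n → ℝ)) (ν : ℝ → (Fin n → ℝ) → (Fin n → ℝ))
    -- the divergence theorem on W(t) with outward unit normal ν t and surface measure σ t:
    (hdivthm : ∀ (t : ℝ) (F : (Fin n → ℝ) → (Fin n → ℝ)), ContDiff ℝ 1 F →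
      (∫ y in φ t '' W₀, LinearMap.trace ℝ (Fin n → ℝ) ((fderiv ℝ F y).toLinearMap)) =
        ∫ y in frontier (φ t '' W₀), F y ⬝ᵥ ν t y ∂(σ t)) :
    ∀ t : ℝ,
      HasDerivAt (fun s => ∫ y in φ s '' W₀, T y s)
        ((∫ y in φ t '' W₀, deriv (fun s => T y s) t) +
          ∫ y in φ t '' W₀,
            LinearMap.trace ℝ (Fin n → ℝ)
              ((fderiv ℝ (fun y => T y t • V y) y).toLinearMap)) t ∧
      (∫ y in φ t '' W₀,
          LinearMap.trace ℝ (Fin n → ℝ)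
            ((fderiv ℝ (fun y => T y t • V y) y).toLinearMap)) =
        ∫ y in frontier (φ t '' W₀), T y t * (V y ⬝ᵥ ν t y) ∂(σ t) := by
  intro t
  have hTt : ContDiff ℝ 1 (fun y => T y t) :=
    hT.comp (contDiff_id.prodMk contDiff_const)
  have hTV : ContDiff ℝ 1 (fun y => T y t • V y) := hTt.smul hV
  refine ⟨?_, ?_⟩
  swap
  · rw [hdivthm t _ hTV]
    simp only [smul_dotProduct, smul_eq_mul]
  have hφc := Reynolds.flow_continuous hV hflow hφ0 hgroup
  have hinv : ∀ s x, φ (-s) (φ s x) = x := fun s x => by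
    have := congrFun (hgroup (-s) s) x
    simpa [hφ0] using this.symm
  have hinv' : ∀ s x, φ s (φ (-s) x) = x := fun s x => by
    simpa using hinv (-s) x
  set W := φ t '' W₀
  have hWo : IsOpen W := by
    have : W = φ (-t) ⁻¹' W₀ := by
      ext y
      constructor
      · rintro ⟨x, hx, rfl⟩
        simpa [hinv] using hx
      · intro hy
        exact ⟨_, hy, hinv' t y⟩
    rw [this]
    exact hW₀.preimage (hφc _)
  have hWb : Bornology.IsBounded W :=
    (hW₀b.isCompact_closure.image (hφc t)).isBounded.subset (Set.image_mono subset_closure)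
  set g : (Fin n → ℝ) × ℝ → ℝ := fun p => T p.1 (t + p.2) with hgdef
  have hg : ContDiff ℝ 1 g :=
    hT.comp (contDiff_fst.prodMk (contDiff_const.add contDiff_snd))
  have hcore := Reynolds.core hV hflow hφ0 hgroup hg hWo hWb
  have hcore' := HasDerivAt.comp_sub_const (x := t) (a := t) (by rw [sub_self]; exact hcore)
  have hfun : (fun s => ∫ y in φ s '' W₀, T y s) =
      fun s => ∫ y in φ (s - t) '' W, g (y, s - t) := by
    ext s
    have : φ (s - t) '' W = φ s '' W₀ := by
      rw [← Set.image_comp, ← hgroup, sub_add_cancel]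
    rw [this]
    simp [hgdef]
  rw [hfun]
  convert! hcore' using 1
  have hgd : Differentiable ℝ g := hg.differentiable one_ne_zero
  have p1 : ∀ y, deriv (fun s => T y s) t = fderiv ℝ g (y, 0) (0, 1) := by
    intro y
    have d1 : HasDerivAt (fun s : ℝ => (y, s - t)) ((0 : Fin n → ℝ), (1 : ℝ)) t :=
      (hasDerivAt_const t y).prodMk ((hasDerivAt_id t).sub_const t)
    have d2 := HasFDerivAt.comp_hasDerivAt_of_eq t (hgd (y, 0)).hasFDerivAt d1 (by simp)
    rw [← d2.deriv]
    congr 1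
    ext s
    simp [hgdef]
  have p2 : ∀ y v, fderiv ℝ (fun y => T y t) y v = fderiv ℝ g (y, 0) (v, 0) := by
    intro y v
    have d1 : HasFDerivAt (fun y : Fin n → ℝ => (y, (0 : ℝ)))
        (ContinuousLinearMap.inl ℝ (Fin n → ℝ) ℝ) y := hasFDerivAt_prodMk_left y 0
    have d2 := HasFDerivAt.comp y (hgd (y, 0)).hasFDerivAt d1
    have e : g ∘ (fun y : Fin n → ℝ => (y, (0 : ℝ))) = fun y => T y t := by
      ext y; simp [hgdef]
    rw [e] at d2
    rw [d2.fderiv]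
    simp
  have p3 : ∀ y, LinearMap.trace ℝ (Fin n → ℝ)
      ((fderiv ℝ (fun y => T y t • V y) y).toLinearMap) =
      Reynolds.ctr n (fderiv ℝ V y) * g (y, 0) + fderiv ℝ g (y, 0) (V y, 0) := by
    intro y
    have hd := ((hTt.differentiable one_ne_zero y).hasFDerivAt).smul
      ((hV.differentiable one_ne_zero y).hasFDerivAt)
    have hd' : fderiv ℝ (fun y => T y t • V y) y = _ := hd.fderiv
    rw [hd', ← p2, ← Reynolds.ctr_apply, map_add, map_smul, smul_eq_mul]
    have e1 : g (y, 0) = T y t := by simp [hgdef]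
    rw [e1, mul_comm]
    congr 1
    rw [Reynolds.ctr_apply]
    exact LinearMap.trace_smulRight _ _
  have hDg : Continuous (fderiv ℝ g) := hg.continuous_fderiv one_ne_zero
  have hVc := hV.continuous
  have hDV := hV.continuous_fderiv one_ne_zero
  have hgc := hg.continuous
  have hinteg : ∀ {f : (Fin n → ℝ) → ℝ}, Continuous f → Integrable f (volume.restrict W) := by
    intro f hf
    exact (hf.continuousOn.integrableOn_compact hWb.isCompact_closure).mono_set subset_closure
  simp_rw [p1, p3]
  rw [← integral_add (hinteg (by fun_prop)) (hinteg (by fun_prop))]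
  congr 1
  ext y
  have : ((V y, 1) : (Fin n → ℝ) × ℝ) = (V y, 0) + (0, 1) := by simp
  rw [this, map_add]
  ring
end
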